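/- Let β ∈ (0,1), α > 0, μ > 0, t > 0, and δ ∈ (β/(2α²), β/α). For every ε ∈ (0,1], E_β²(−μ t^β ε^{−δα})/ε^{β/α} ≤ 1/(ε^{β/α} + μ² t^{2β} ε^{β/α − 2δα}/Γ²(1+β)), and consequently E_β²(−μ t^β ε^{−δα})/ε^{β/α} → 0 as ε → 0⁺. -/

import Mathlib

open Real Filter Topology

/-- The Mittag-Leffler function `E_β(s) = ∑_{k=0}^∞ s^k / Γ(1 + βk)`. -/
noncomputable def mittagLeffler (β s : ℝ) : ℝ := ∑' k : ℕ, s ^ k / Real.Gamma (1 + β * k)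

lemma ml_hasSum_congr {f g : ℕ → ℝ} {a : ℝ} (h : ∀ k, f k = g k) : HasSum f a ↔ HasSum g a := by
  rw [funext h]

/-- Approximants of `1 / Γ(1+s)`. -/
noncomputable def mlA (n : ℕ) (s : ℝ) : ℝ :=
  (n : ℝ) ^ (-s) * ∏ m ∈ Finset.range n, (1 + s / ((m : ℝ) + 1))

lemma ml_coeff (β : ℝ) (h0 : 0 < β) (h1 : β < 1) (n : ℕ) :
    ∃ c : ℕ → ℝ, (∀ j, 0 ≤ c j) ∧ ∀ k : ℕ,
      ∏ m ∈ Finset.range n, (1 + β * k / ((m : ℝ) + 1)) =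
        ∑ j ∈ Finset.range (n + 1), c j * ((k + j).choose j : ℝ) := by
  induction n with
  | zero => exact ⟨fun _ => 1, fun _ => zero_le_one, fun k => by simp⟩
  | succ n ih =>
    obtain ⟨c, hc, hk⟩ := ih
    have hn : (0 : ℝ) < (n : ℝ) + 1 := by positivity
    refine ⟨fun j => (if j ≤ n then c j * (1 - β * ((j : ℝ) + 1) / (n + 1)) else 0) +
      (if 1 ≤ j then c (j - 1) * (β * j / (n + 1)) else 0), ?_, ?_⟩
    · intro j
      apply add_nonneg
      · split_ifs with hj
        · apply mul_nonneg (hc j)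
          rw [sub_nonneg, div_le_one hn]
          have : (j : ℝ) ≤ n := by exact_mod_cast hj
          nlinarith
        · exact le_rfl
      · split_ifs with hj
        · exact mul_nonneg (hc _) (by positivity)
        · exact le_rfl
    · intro k
      rw [Finset.prod_range_succ, hk k]
      simp only [add_mul, Finset.sum_add_distrib]
      rw [Finset.sum_range_succ (n := n + 1), Finset.sum_range_succ' (n := n + 1)]
      simp only [show ¬ (n + 1 ≤ n) by omega, if_false, zero_mul, add_zero,
        show ¬ (1 ≤ 0) by omega]
      rw [Finset.sum_mul, ← Finset.sum_add_distrib]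
      apply Finset.sum_congr rfl
      intro j hj
      have hj' : j ≤ n := by simpa [Nat.lt_succ_iff] using hj
      simp only [hj', if_true, show 1 ≤ j + 1 by omega, Nat.add_sub_cancel]
      have key : (k : ℝ) * ((k + j).choose j : ℝ) =
          ((j : ℝ) + 1) * (((k + (j + 1)).choose (j + 1) : ℝ) - ((k + j).choose j : ℝ)) := by
        have h := Nat.add_one_mul_choose_eq (k + j) j
        have h' : ((k : ℝ) + j + 1) * ((k + j).choose j : ℝ)
            = ((k + (j + 1)).choose (j + 1) : ℝ) * ((j : ℝ) + 1) := by
          rw [← add_assoc k j 1]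
          exact_mod_cast h
        linarith
      have e : c j * ((k + j).choose j : ℝ) * (1 + β * k / ((n : ℝ) + 1)) =
        c j * ((k + j).choose j : ℝ) + c j * β / (n + 1) * ((k : ℝ) * ((k + j).choose j : ℝ)) := by
        field_simp
      rw [e, key]
      push_cast
      field_simp
      ring

lemma ml_rational (β : ℝ) (h0 : 0 < β) (h1 : β < 1) (n : ℕ) :
    ∃ c : ℕ → ℝ, (∀ j, 0 ≤ c j) ∧ ∀ y : ℝ, |y| < 1 →
      HasSum (fun k : ℕ => y ^ k * ∏ m ∈ Finset.range n, (1 + β * k / ((m : ℝ) + 1)))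
        (∑ j ∈ Finset.range (n + 1), c j * (1 / (1 - y) ^ (j + 1))) := by
  obtain ⟨c, hc, hk⟩ := ml_coeff β h0 h1 n
  refine ⟨c, hc, fun y hy => ?_⟩
  have := hasSum_sum (s := Finset.range (n + 1)) (fun j _ =>
    (hasSum_choose_mul_geometric_of_norm_lt_one (𝕜 := ℝ) j (r := y) hy).mul_left (c j))
  refine (ml_hasSum_congr fun k => ?_).2 this
  rw [hk, Finset.mul_sum]
  exact Finset.sum_congr rfl fun j _ => by ring

lemma mlA_pow (β x : ℝ) (n k : ℕ) :
    x ^ k * mlA n (β * k) =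
      (x / (n : ℝ) ^ β) ^ k * ∏ m ∈ Finset.range n, (1 + β * k / ((m : ℝ) + 1)) := by
  rw [mlA, Real.rpow_neg (by positivity), Real.rpow_mul (by positivity), Real.rpow_natCast, div_pow]
  ring

lemma mlA_summable (β : ℝ) (h0 : 0 < β) (h1 : β < 1) (n : ℕ) (x : ℝ) (hx : |x| < (n : ℝ) ^ β) :
    Summable (fun k : ℕ => x ^ k * mlA n (β * k)) := by
  obtain ⟨c, -, h⟩ := ml_rational β h0 h1 n
  simp only [mlA_pow]
  have hp : 0 < (n : ℝ) ^ β := (abs_nonneg x).trans_lt hx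
  exact (h _ (by rw [abs_div, abs_of_pos hp, div_lt_one hp]; exact hx)).summable

lemma mlA_tsum_mono (β : ℝ) (h0 : 0 < β) (h1 : β < 1) (n : ℕ) (x y : ℝ) (hx : 0 ≤ x)
    (hxy : x ≤ y) (hy : y < (n : ℝ) ^ β) :
    0 ≤ ∑' k : ℕ, (-y) ^ k * mlA n (β * k) ∧
    ∑' k : ℕ, (-y) ^ k * mlA n (β * k) ≤ ∑' k : ℕ, (-x) ^ k * mlA n (β * k) := by
  obtain ⟨c, hc, h⟩ := ml_rational β h0 h1 n
  simp only [mlA_pow]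
  have hy0 : 0 ≤ y := hx.trans hxy
  have hp : 0 < (n : ℝ) ^ β := hy0.trans_lt hy
  rw [(h _ (by rw [abs_div, abs_of_pos hp, div_lt_one hp, abs_neg, abs_of_nonneg hy0]; exact hy)).tsum_eq,
    (h _ (by rw [abs_div, abs_of_pos hp, div_lt_one hp, abs_neg, abs_of_nonneg hx]; linarith)).tsum_eq]
  simp only [neg_div, sub_neg_eq_add]
  constructor
  · exact Finset.sum_nonneg fun j _ => mul_nonneg (hc j) (by positivity)
  · apply Finset.sum_le_sum
    intro j _
    apply mul_le_mul_of_nonneg_left _ (hc j)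
    gcongr

lemma mlA_tendsto (s : ℝ) (hs : 0 ≤ s) :
    Tendsto (fun n : ℕ => mlA n s) atTop (𝓝 (1 / Real.Gamma (1 + s))) := by
  rcases hs.eq_or_lt with rfl | hs
  · simp [mlA]
  have h := (Real.GammaSeq_tendsto_Gamma s).const_mul s
  rw [← Real.Gamma_add_one hs.ne', add_comm] at h
  have h2 := h.inv₀ (Real.Gamma_pos_of_pos (by linarith)).ne'
  rw [one_div]
  refine h2.congr fun n => ?_
  rw [Real.GammaSeq, mlA, Finset.prod_range_succ', Real.rpow_neg (by positivity)]
  have e : (n.factorial : ℝ) = ∏ m ∈ Finset.range n, ((m : ℝ) + 1) := by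
    rw [← Finset.prod_range_add_one_eq_factorial]; push_cast; rfl
  have e2 : ∏ m ∈ Finset.range n, (1 + s / ((m : ℝ) + 1)) =
     (∏ m ∈ Finset.range n, (s + ((m + 1 : ℕ) : ℝ))) / n.factorial := by
    rw [e, ← Finset.prod_div_distrib]
    refine Finset.prod_congr rfl fun m _ => ?_
    push_cast
    field_simp
    ring
  rw [e2]
  have hq : (∏ m ∈ Finset.range n, (s + ((m + 1 : ℕ) : ℝ))) ≠ 0 :=
    Finset.prod_ne_zero_iff.2 fun m _ => by positivity
  simp only [Nat.cast_zero, add_zero, mul_inv, inv_div]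
  field_simp

lemma mlA_nonneg (n : ℕ) (s : ℝ) (hs : 0 ≤ s) : 0 ≤ mlA n s :=
  mul_nonneg (by positivity) (Finset.prod_nonneg fun m _ => by positivity)

lemma mlA_anti (n : ℕ) (hn : 1 ≤ n) (s : ℝ) (hs : 1 ≤ s) : mlA (n + 1) s ≤ mlA n s := by
  have hn0 : (0 : ℝ) < n := by exact_mod_cast hn
  rw [mlA, mlA, Finset.prod_range_succ]
  have hP : 0 ≤ ∏ m ∈ Finset.range n, (1 + s / ((m : ℝ) + 1)) :=
    Finset.prod_nonneg fun m _ => by positivity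
  have : ((n + 1 : ℕ) : ℝ) ^ (-s) * (1 + s / ((n : ℝ) + 1)) ≤ (n : ℝ) ^ (-s) := by
    have hb := one_add_mul_self_le_rpow_one_add (s := 1 / (n : ℝ)) (p := s)
      (by have : 0 < 1 / (n : ℝ) := by positivity
          linarith) hs
    rw [Real.rpow_neg (by positivity), Real.rpow_neg (by positivity)]
    have e : (1 + 1 / (n : ℝ)) ^ s = ((n + 1 : ℕ) : ℝ) ^ s / (n : ℝ) ^ s := by
      rw [← Real.div_rpow (by positivity) (by positivity)]
      congr 1
      push_cast
      field_simp
    rw [e] at hb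
    have h3 : s / ((n : ℝ) + 1) ≤ s * (1 / n) := by
      rw [mul_one_div]; gcongr; linarith
    have h4 : 1 + s / ((n : ℝ) + 1) ≤ ((n + 1 : ℕ) : ℝ) ^ s / (n : ℝ) ^ s := by linarith
    have hpp : 0 < ((n + 1 : ℕ) : ℝ) ^ s := by positivity
    calc _ ≤ (((n + 1 : ℕ) : ℝ) ^ s)⁻¹ * (((n + 1 : ℕ) : ℝ) ^ s / (n : ℝ) ^ s) := by gcongr
      _ = _ := by field_simp
  calc _ = (((n + 1 : ℕ) : ℝ) ^ (-s) * (1 + s / ((n : ℝ) + 1))) *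
        ∏ m ∈ Finset.range n, (1 + s / ((m : ℝ) + 1)) := by ring
    _ ≤ _ := by gcongr

lemma mlA_le_exp (n : ℕ) (hn : 1 ≤ n) (s : ℝ) (hs : 0 ≤ s) : mlA n s ≤ Real.exp s := by
  have hn0 : (0 : ℝ) < n := by exact_mod_cast hn
  have h1 : ∏ m ∈ Finset.range n, (1 + s / ((m : ℝ) + 1)) ≤ Real.exp (s * (1 + Real.log n)) := by
    calc _ ≤ ∏ m ∈ Finset.range n, Real.exp (s / ((m : ℝ) + 1)) := by
          apply Finset.prod_le_prod
          · intro m _; positivity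
          · intro m _
            have := Real.add_one_le_exp (s / ((m : ℝ) + 1))
            linarith
      _ = Real.exp (s * (harmonic n : ℝ)) := by
          rw [← Real.exp_sum, harmonic]
          push_cast
          rw [Finset.mul_sum]
          simp only [div_eq_mul_inv]
      _ ≤ _ := by
          gcongr
          exact harmonic_le_one_add_log n
  rw [mlA, Real.rpow_def_of_pos hn0]
  calc _ ≤ Real.exp (Real.log n * -s) * Real.exp (s * (1 + Real.log n)) := by gcongr
    _ = _ := by rw [← Real.exp_add]; congr 1; ring

lemma mlA_dom (N n : ℕ) (hN : 1 ≤ N) (hn : N ≤ n) (s : ℝ) (hs : 0 ≤ s) :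
    mlA n s ≤ Real.exp 1 * N * mlA N s := by
  have hN0 : (1 : ℝ) ≤ N := by exact_mod_cast hN
  have he : 1 ≤ Real.exp 1 := Real.one_le_exp (by norm_num)
  rcases le_total 1 s with h | h
  · have : mlA n s ≤ mlA N s := by
      induction n, hn using Nat.le_induction with
      | base => exact le_rfl
      | succ n hn ih => exact (mlA_anti n (hN.trans hn) s h).trans ih
    refine this.trans (le_mul_of_one_le_left (mlA_nonneg N s hs) ?_)
    nlinarith
  · have h1 : (N : ℝ)⁻¹ ≤ mlA N s := by
      rw [mlA]
      have a : (N : ℝ)⁻¹ ≤ (N : ℝ) ^ (-s) := by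
        rw [← Real.rpow_neg_one]
        exact Real.rpow_le_rpow_of_exponent_le hN0 (by linarith)
      have b : 1 ≤ ∏ m ∈ Finset.range N, (1 + s / ((m : ℝ) + 1)) := by
        apply Finset.one_le_prod
        intro m _
        have : 0 ≤ s / ((m : ℝ) + 1) := by positivity
        linarith
      exact a.trans (le_mul_of_one_le_right (by positivity) b)
    calc mlA n s ≤ Real.exp s := mlA_le_exp n (hN.trans hn) s hs
      _ ≤ Real.exp 1 := by gcongr
      _ = Real.exp 1 * N * (N : ℝ)⁻¹ := by field_simp
      _ ≤ _ := by gcongr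

lemma ml_exists_N (β : ℝ) (h0 : 0 < β) (x : ℝ) :
    ∃ N : ℕ, 1 ≤ N ∧ ∀ n, N ≤ n → x < (n : ℝ) ^ β := by
  have h := (tendsto_rpow_atTop h0).comp (tendsto_natCast_atTop_atTop (R := ℝ))
  obtain ⟨N, hN⟩ := eventually_atTop.1 (h.eventually_gt_atTop x)
  exact ⟨max N 1, le_max_right _ _, fun n hn => hN n ((le_max_left _ _).trans hn)⟩

lemma ml_summable (β : ℝ) (h0 : 0 < β) (h1 : β < 1) (x : ℝ) :
    Summable (fun k : ℕ => x ^ k / Real.Gamma (1 + β * k)) := by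
  obtain ⟨N, hN, hx⟩ := ml_exists_N β h0 |x|
  have hs := (mlA_summable β h0 h1 N |x| (by rw [abs_abs]; exact hx N le_rfl)).mul_left
    (Real.exp 1 * N)
  refine Summable.of_norm_bounded hs fun k => ?_
  have hk : 0 ≤ β * k := by positivity
  have hG : 0 < Real.Gamma (1 + β * k) := Real.Gamma_pos_of_pos (by linarith)
  have := le_of_tendsto (mlA_tendsto (β * k) hk)
    (eventually_atTop.2 ⟨N, fun n hn => mlA_dom N n hN hn (β * k) hk⟩)
  rw [Real.norm_eq_abs, abs_div, abs_pow, abs_of_pos hG]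
  calc _ = |x| ^ k * (1 / Real.Gamma (1 + β * k)) := by ring
    _ ≤ |x| ^ k * (Real.exp 1 * N * mlA N (β * k)) := by gcongr
    _ = _ := by ring

lemma ml_tendsto (β : ℝ) (h0 : 0 < β) (h1 : β < 1) (x : ℝ) :
    Tendsto (fun n : ℕ => ∑' k : ℕ, x ^ k * mlA n (β * k)) atTop (𝓝 (mittagLeffler β x)) := by
  obtain ⟨N, hN, hx⟩ := ml_exists_N β h0 |x|
  have hs := (mlA_summable β h0 h1 N |x| (by rw [abs_abs]; exact hx N le_rfl)).mul_left
    (Real.exp 1 * N)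
  refine tendsto_tsum_of_dominated_convergence hs (fun k => ?_) ?_
  · have := (mlA_tendsto (β * k) (by positivity)).const_mul (x ^ k)
    rwa [mul_one_div] at this
  · filter_upwards [eventually_ge_atTop N] with n hn k
    have hk : 0 ≤ β * k := by positivity
    rw [Real.norm_eq_abs, abs_mul, abs_pow, abs_of_nonneg (mlA_nonneg n _ hk)]
    calc _ ≤ |x| ^ k * (Real.exp 1 * N * mlA N (β * k)) := by
          gcongr; exact mlA_dom N n hN hn _ hk
      _ = _ := by ring

lemma ml_mono (β : ℝ) (h0 : 0 < β) (h1 : β < 1) (x y : ℝ) (hx : 0 ≤ x) (hxy : x ≤ y) :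
    0 ≤ mittagLeffler β (-y) ∧ mittagLeffler β (-y) ≤ mittagLeffler β (-x) := by
  obtain ⟨N, hN, hy⟩ := ml_exists_N β h0 y
  have h := fun n hn => mlA_tsum_mono β h0 h1 n x y hx hxy (hy n hn)
  exact ⟨ge_of_tendsto (ml_tendsto β h0 h1 (-y))
      (eventually_atTop.2 ⟨N, fun n hn => (h n hn).1⟩),
    le_of_tendsto_of_tendsto (ml_tendsto β h0 h1 (-y)) (ml_tendsto β h0 h1 (-x))
      (eventually_atTop.2 ⟨N, fun n hn => (h n hn).2⟩)⟩

open MeasureTheory in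
lemma ml_beta (a b : ℝ) (ha : 0 < a) (hb : 0 < b) :
    IntegrableOn (fun s : ℝ => s ^ (a - 1) * (1 - s) ^ (b - 1)) (Set.Ioo 0 1) ∧
    ∫ s in Set.Ioo (0 : ℝ) 1, s ^ (a - 1) * (1 - s) ^ (b - 1) =
      Real.Gamma a * Real.Gamma b / Real.Gamma (a + b) := by
  have h := ProbabilityTheory.lintegral_betaPDF_eq_one ha hb
  rw [ProbabilityTheory.lintegral_betaPDF] at h
  have hB := ProbabilityTheory.beta_pos ha hb
  set B := ProbabilityTheory.beta a b with hBd
  have hnn : 0 ≤ᵐ[volume.restrict (Set.Ioo (0 : ℝ) 1)]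
      fun s : ℝ => 1 / B * s ^ (a - 1) * (1 - s) ^ (b - 1) := by
    filter_upwards [ae_restrict_mem measurableSet_Ioo] with s hs
    have h1 := hs.1
    have h2 : 0 < 1 - s := by linarith [hs.2]
    simp only [Pi.zero_apply]
    positivity
  have hm : AEStronglyMeasurable (fun s : ℝ => 1 / B * s ^ (a - 1) * (1 - s) ^ (b - 1))
      (volume.restrict (Set.Ioo (0 : ℝ) 1)) := by
    apply Measurable.aestronglyMeasurable
    fun_prop
  have hi : Integrable (fun s : ℝ => 1 / B * s ^ (a - 1) * (1 - s) ^ (b - 1))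
      (volume.restrict (Set.Ioo (0 : ℝ) 1)) := by
    refine ⟨hm, ?_⟩
    rw [hasFiniteIntegral_iff_ofReal hnn, h]
    exact ENNReal.one_lt_top
  have hv : ∫ s in Set.Ioo (0 : ℝ) 1, 1 / B * s ^ (a - 1) * (1 - s) ^ (b - 1) = 1 := by
    rw [integral_eq_lintegral_of_nonneg_ae hnn hm, h]; rfl
  have e : (fun s : ℝ => s ^ (a - 1) * (1 - s) ^ (b - 1)) =
      fun s : ℝ => B * (1 / B * s ^ (a - 1) * (1 - s) ^ (b - 1)) := by
    ext s; field_simp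
  rw [e]
  refine ⟨hi.const_mul B, ?_⟩
  rw [integral_const_mul, hv, mul_one, hBd, ProbabilityTheory.beta]

open MeasureTheory in
lemma ml_bound (β : ℝ) (h0 : 0 < β) (h1 : β < 1) (x : ℝ) (hx : 0 < x) :
    mittagLeffler β (-x) * (1 + x / Real.Gamma (1 + β)) ≤ 1 := by
  have hGβ : 0 < Real.Gamma β := Real.Gamma_pos_of_pos h0
  have hG : ∀ k : ℕ, 0 < Real.Gamma (1 + β * k) := fun k =>
    Real.Gamma_pos_of_pos (by positivity)
  let F : ℕ → ℝ → ℝ := fun k s =>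
    (-x) ^ k / Real.Gamma (1 + β * k) * (s ^ ((1 + β * k) - 1) * (1 - s) ^ (β - 1))
  have hb := fun k : ℕ => ml_beta (1 + β * k) β (by positivity) h0
  have hFi : ∀ k, Integrable (F k) (volume.restrict (Set.Ioo (0 : ℝ) 1)) := fun k =>
    (hb k).1.const_mul _
  have hFv : ∀ k : ℕ, ∫ s in Set.Ioo (0 : ℝ) 1, F k s =
      (-x) ^ k * Real.Gamma β / Real.Gamma (1 + β * ((k + 1 : ℕ) : ℝ)) := by
    intro k
    simp only [F]
    rw [integral_const_mul, (hb k).2]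
    have : 1 + β * (k : ℝ) + β = 1 + β * ((k + 1 : ℕ) : ℝ) := by push_cast; ring
    rw [this]
    have := hG k
    field_simp
  have hFn : ∀ k : ℕ, ∫ s in Set.Ioo (0 : ℝ) 1, ‖F k s‖ =
      x ^ k * Real.Gamma β / Real.Gamma (1 + β * ((k + 1 : ℕ) : ℝ)) := by
    intro k
    have : ∫ s in Set.Ioo (0 : ℝ) 1, ‖F k s‖ = ∫ s in Set.Ioo (0 : ℝ) 1,
        x ^ k / Real.Gamma (1 + β * k) * (s ^ ((1 + β * k) - 1) * (1 - s) ^ (β - 1)) := by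
      apply setIntegral_congr_fun measurableSet_Ioo
      intro s hs
      have h1 := hs.1
      have h2 : 0 < 1 - s := by linarith [hs.2]
      have h3 : 0 ≤ s ^ ((1 + β * k) - 1) * (1 - s) ^ (β - 1) := by positivity
      simp only [F]
      rw [Real.norm_eq_abs, abs_mul, abs_of_nonneg h3, abs_div, abs_pow, abs_neg, abs_of_pos hx,
        abs_of_pos (hG k)]
    rw [this, integral_const_mul, (hb k).2]
    have : 1 + β * (k : ℝ) + β = 1 + β * ((k + 1 : ℕ) : ℝ) := by push_cast; ring
    rw [this]
    have := hG k
    field_simp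
  have hsum : Summable fun k => ∫ s in Set.Ioo (0 : ℝ) 1, ‖F k s‖ := by
    have := ((summable_nat_add_iff 1).2 (ml_summable β h0 h1 x)).mul_left (Real.Gamma β / x)
    refine this.congr fun k => ?_
    rw [hFn, pow_succ]
    field_simp
  have hS := hasSum_integral_of_summable_integral_norm hFi hsum
  have e2 : ∀ s ∈ Set.Ioo (0 : ℝ) 1,
      HasSum (fun k => F k s) (mittagLeffler β (-(x * s ^ β)) * (1 - s) ^ (β - 1)) := by
    intro s hs
    refine (ml_hasSum_congr fun k => ?_).2
      ((ml_summable β h0 h1 (-(x * s ^ β))).hasSum.mul_right ((1 - s) ^ (β - 1)))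
    simp only [F]
    rw [add_sub_cancel_left, Real.rpow_mul hs.1.le, Real.rpow_natCast, ← neg_mul, mul_pow]
    ring
  have hb0 := ml_beta 1 β one_pos h0
  have hint : IntegrableOn (fun s => ∑' k, F k s) (Set.Ioo (0 : ℝ) 1) := by
    have hmeas : AEStronglyMeasurable (fun s => ∑' k, F k s)
        (volume.restrict (Set.Ioo (0 : ℝ) 1)) := by
      refine aestronglyMeasurable_of_tendsto_ae (u := atTop)
        (f := fun (n : ℕ) s => ∑ k ∈ Finset.range n, F k s) ?_ ?_
      · intro n
        exact (integrable_finsetSum _ fun k _ => hFi k).aestronglyMeasurable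
      · filter_upwards [ae_restrict_mem measurableSet_Ioo] with s hs
        rw [(e2 s hs).tsum_eq]
        exact (e2 s hs).tendsto_sum_nat
    refine Integrable.mono' (hb0.1.const_mul (mittagLeffler β (-0))) hmeas ?_
    filter_upwards [ae_restrict_mem measurableSet_Ioo] with s hs
    have h1' := hs.1
    have h2 : 0 < 1 - s := by linarith [hs.2]
    have hm := ml_mono β h0 h1 0 (x * s ^ β) le_rfl (by positivity)
    have h3 : 0 ≤ (1 - s) ^ (β - 1) := by positivity
    rw [(e2 s hs).tsum_eq, sub_self, Real.rpow_zero, one_mul, Real.norm_eq_abs,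
      abs_of_nonneg (mul_nonneg hm.1 h3)]
    exact mul_le_mul_of_nonneg_right hm.2 h3
  set I := ∫ s in Set.Ioo (0 : ℝ) 1, ∑' k, F k s with hI
  have hE : mittagLeffler β (-x) = 1 - x / Real.Gamma β * I := by
    have hs := ml_summable β h0 h1 (-x)
    rw [mittagLeffler, hs.tsum_eq_zero_add, ← hS.tsum_eq, ← tsum_mul_left, sub_eq_add_neg,
      ← tsum_neg]
    congr 1
    · simp
    · refine tsum_congr fun k => ?_
      rw [hFv, pow_succ]
      field_simp
  have hle : mittagLeffler β (-x) * (1 / β) ≤ I := by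
    have e : ∫ s in Set.Ioo (0 : ℝ) 1,
        mittagLeffler β (-x) * (s ^ ((1 : ℝ) - 1) * (1 - s) ^ (β - 1)) =
        mittagLeffler β (-x) * (1 / β) := by
      rw [integral_const_mul, hb0.2, Real.Gamma_one, add_comm, Real.Gamma_add_one h0.ne']
      field_simp
    rw [← e, hI]
    refine setIntegral_mono_on (hb0.1.const_mul _) hint measurableSet_Ioo fun s hs => ?_
    have h1' := hs.1
    have h2 : 0 < 1 - s := by linarith [hs.2]
    rw [(e2 s hs).tsum_eq, sub_self, Real.rpow_zero, one_mul]
    apply mul_le_mul_of_nonneg_right _ (by positivity)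
    refine (ml_mono β h0 h1 _ _ (by positivity) ?_).2
    have : s ^ β ≤ 1 := Real.rpow_le_one h1'.le hs.2.le h0.le
    nlinarith
  have hc : 0 < x / Real.Gamma β := by positivity
  have := mul_le_mul_of_nonneg_left hle hc.le
  rw [add_comm 1 β, Real.Gamma_add_one h0.ne']
  have e : mittagLeffler β (-x) * (1 + x / (β * Real.Gamma β)) =
    mittagLeffler β (-x) + x / Real.Gamma β * (mittagLeffler β (-x) * (1 / β)) := by
    field_simp
  rw [e]
  linarith

lemma ml_sq_bound (β : ℝ) (h0 : 0 < β) (h1 : β < 1) (x : ℝ) (hx : 0 < x) :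
    mittagLeffler β (-x) ^ 2 * (1 + x ^ 2 / Real.Gamma (1 + β) ^ 2) ≤ 1 := by
  have hb := ml_bound β h0 h1 x hx
  have hn := (ml_mono β h0 h1 x x hx.le le_rfl).1
  have hG : 0 < Real.Gamma (1 + β) := Real.Gamma_pos_of_pos (by linarith)
  rw [← div_pow]
  have hc : 0 < x / Real.Gamma (1 + β) := by positivity
  set c := x / Real.Gamma (1 + β)
  set E := mittagLeffler β (-x)
  have h2 : (E * (1 + c)) ^ 2 ≤ 1 := pow_le_one₀ (by positivity) hb
  have h3 : 0 ≤ E ^ 2 * (2 * c) := by positivity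
  nlinarith

/-- For `β ∈ (0,1)`, `α > 0`, `μ > 0`, `t > 0`, `δ ∈ (β/(2α²), β/α)`: for every `ε ∈ (0,1]`,
`E_β²(−μ t^β ε^{−δα})/ε^{β/α} ≤ 1/(ε^{β/α} + μ² t^{2β} ε^{β/α−2δα}/Γ²(1+β))`,
and consequently `E_β²(−μ t^β ε^{−δα})/ε^{β/α} → 0` as `ε → 0⁺`. -/
theorem mittagLeffler_sq_div_rpow_bound_and_tendsto (β α μ t δ : ℝ)
    (hβ : β ∈ Set.Ioo (0 : ℝ) 1) (hα : 0 < α) (hμ : 0 < μ) (ht : 0 < t)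
    (hδ : δ ∈ Set.Ioo (β / (2 * α ^ 2)) (β / α)) :
    (∀ ε : ℝ, ε ∈ Set.Ioc (0 : ℝ) 1 →
      (mittagLeffler β (-(μ * t ^ β * ε ^ (-(δ * α))))) ^ 2 / ε ^ (β / α) ≤
        1 / (ε ^ (β / α) +
          μ ^ 2 * t ^ (2 * β) * ε ^ (β / α - 2 * δ * α) / (Real.Gamma (1 + β)) ^ 2)) ∧
    Filter.Tendsto
      (fun ε : ℝ => (mittagLeffler β (-(μ * t ^ β * ε ^ (-(δ * α))))) ^ 2 / ε ^ (β / α))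
      (𝓝[>] (0 : ℝ)) (𝓝 0) := by
  obtain ⟨h0, h1⟩ := hβ
  have hG : 0 < Real.Gamma (1 + β) := Real.Gamma_pos_of_pos (by linarith)
  have key : ∀ ε : ℝ, 0 < ε →
      (mittagLeffler β (-(μ * t ^ β * ε ^ (-(δ * α))))) ^ 2 / ε ^ (β / α) ≤
        1 / (ε ^ (β / α) +
          μ ^ 2 * t ^ (2 * β) * ε ^ (β / α - 2 * δ * α) / (Real.Gamma (1 + β)) ^ 2) := by
    intro ε hε
    have h := ml_sq_bound β h0 h1 (μ * t ^ β * ε ^ (-(δ * α))) (by positivity)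
    have e1 : t ^ (2 * β) = (t ^ β) ^ 2 := by
      rw [mul_comm, Real.rpow_mul ht.le]; norm_cast
    have e2 : ε ^ (β / α - 2 * δ * α) = ε ^ (β / α) * (ε ^ (-(δ * α))) ^ 2 := by
      rw [← Real.rpow_natCast (ε ^ (-(δ * α))) 2, ← Real.rpow_mul hε.le, ← Real.rpow_add hε]
      congr 1
      push_cast
      ring
    have e3 : ε ^ (β / α) +
          μ ^ 2 * t ^ (2 * β) * ε ^ (β / α - 2 * δ * α) / (Real.Gamma (1 + β)) ^ 2 =
        ε ^ (β / α) * (1 + (μ * t ^ β * ε ^ (-(δ * α))) ^ 2 / Real.Gamma (1 + β) ^ 2) := by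
      rw [e1, e2]; ring
    have hp : 0 < ε ^ (β / α) := by positivity
    rw [e3, div_le_div_iff₀ hp (by positivity)]
    calc _ = ε ^ (β / α) * (mittagLeffler β (-(μ * t ^ β * ε ^ (-(δ * α)))) ^ 2 *
          (1 + (μ * t ^ β * ε ^ (-(δ * α))) ^ 2 / Real.Gamma (1 + β) ^ 2)) := by ring
      _ ≤ ε ^ (β / α) * 1 := by gcongr
      _ = _ := by ring
  refine ⟨fun ε hε => key ε hε.1, ?_⟩
  have hexp : 0 < 2 * δ * α - β / α := by
    have := hδ.1
    rw [div_lt_iff₀ (by positivity)] at this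
    rw [sub_pos, div_lt_iff₀ hα]
    nlinarith
  set C := Real.Gamma (1 + β) ^ 2 / (μ ^ 2 * t ^ (2 * β)) with hC
  have hlim : Tendsto (fun ε : ℝ => C * ε ^ (2 * δ * α - β / α)) (𝓝[>] 0) (𝓝 0) := by
    have h := (Real.continuousAt_rpow_const 0 (2 * δ * α - β / α) (Or.inr hexp.le)).tendsto
    rw [Real.zero_rpow hexp.ne'] at h
    simpa using (h.mono_left nhdsWithin_le_nhds).const_mul C
  refine tendsto_of_tendsto_of_tendsto_of_le_of_le' tendsto_const_nhds hlim ?_ ?_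
  · filter_upwards [self_mem_nhdsWithin] with ε hε
    have : 0 < ε := hε
    positivity
  · filter_upwards [self_mem_nhdsWithin] with ε hε
    have hε : 0 < ε := hε
    refine (key ε hε).trans ?_
    have e : C * ε ^ (2 * δ * α - β / α) =
        1 / (μ ^ 2 * t ^ (2 * β) * ε ^ (β / α - 2 * δ * α) / (Real.Gamma (1 + β)) ^ 2) := by
      rw [show 2 * δ * α - β / α = -(β / α - 2 * δ * α) by ring, Real.rpow_neg hε.le, hC]
      field_simp
    rw [e]
    apply one_div_le_one_div_of_le (by positivity)
    have : 0 < ε ^ (β / α) := by positivity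
    linarith
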